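/- arXiv:2312.08135 — 2 statements merged into one kernel-verified Lean document; each statement's English description precedes it below -/
import Mathlib

section
/- Under Assumptions 1, 3, 4 and 5, for every τ > 0 the infimum of ∫ c_τ dγ over γ ∈ A is attained, i.e. there exists γ* ∈ A with ∫ c_τ dγ* = inf_{γ ∈ A} ∫ c_τ dγ < ∞. -/
open MeasureTheory ProbabilityTheory Filter RealInnerProductSpace
open scoped ENNReal

noncomputable section

/-- Euclidean space `ℝ^n`. -/
abbrev Vec (n : ℕ) := EuclideanSpace ℝ (Fin n)

/-- `π` is a coupling of `ν₁` and `ν₂`: a measure on the product whose marginals are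
`ν₁` and `ν₂`. -/
def IsCoupling {X Y : Type*} [MeasurableSpace X] [MeasurableSpace Y]
    (π : Measure (X × Y)) (ν₁ : Measure X) (ν₂ : Measure Y) : Prop :=
  π.map Prod.fst = ν₁ ∧ π.map Prod.snd = ν₂

/-- Squared 2-Wasserstein distance between Borel measures on `ℝ^n`
(as an extended nonnegative real). -/
def W2sq {n : ℕ} (ν₁ ν₂ : Measure (Vec n)) : ℝ≥0∞ :=
  ⨅ π ∈ {π : Measure (Vec n × Vec n) | IsCoupling π ν₁ ν₂},
    ∫⁻ p, ENNReal.ofReal (‖p.1 - p.2‖ ^ 2) ∂π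

/-- `θbar` is a Borel version of the posterior mean `E[Θ | Z]` under the joint law `P`. -/
def IsPosteriorMean {d m : ℕ} (P : Measure (Vec d × Vec m)) (θbar : Vec d → Vec m) : Prop :=
  Measurable θbar ∧
  (fun p => θbar p.1) =ᵐ[P]
    P[(fun p : Vec d × Vec m => p.2) | MeasurableSpace.comap Prod.fst inferInstance]

/-- Marginals of a measure on the 4-fold product `ℝ^d × ℝ^m × ℝ^d × ℝ^d`. -/
def marg1 {d m : ℕ} (γ : Measure (Vec d × Vec m × Vec d × Vec d)) : Measure (Vec d) :=
  γ.map fun p => p.1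
def marg2 {d m : ℕ} (γ : Measure (Vec d × Vec m × Vec d × Vec d)) : Measure (Vec m) :=
  γ.map fun p => p.2.1
def marg3 {d m : ℕ} (γ : Measure (Vec d × Vec m × Vec d × Vec d)) : Measure (Vec d) :=
  γ.map fun p => p.2.2.1
def marg4 {d m : ℕ} (γ : Measure (Vec d × Vec m × Vec d × Vec d)) : Measure (Vec d) :=
  γ.map fun p => p.2.2.2

/-- The feasible set `A` of the Kantorovich relaxation: probability measures `γ` on
`ℝ^d × Ω × ℝ^d × ℝ^d` with `γ₁ = μ`, `γ₄ = μ` and `∫ p(·|θ) dγ₂(θ) = γ₃`. -/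
def FeasibleSet {d m : ℕ} (μ : Measure (Vec d)) (Ω : Set (Vec m))
    (k : Kernel (Vec m) (Vec d)) : Set (Measure (Vec d × Vec m × Vec d × Vec d)) :=
  {γ | IsProbabilityMeasure γ ∧ marg2 γ Ω = 1 ∧
    marg1 γ = μ ∧ marg4 γ = μ ∧ (marg2 γ).bind (fun θ => k θ) = marg3 γ}

/-- The relaxed cost `∫ c_τ dγ` with
`c_τ(z₁,θ,z₃,z₄) = ‖θ − θ̄(z₁)‖² + (1/(2τ))‖z₃ − z₄‖²`. -/
def relaxCost {d m : ℕ} (θbar : Vec d → Vec m) (τ : ℝ)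
    (γ : Measure (Vec d × Vec m × Vec d × Vec d)) : ℝ≥0∞ :=
  ∫⁻ p, ENNReal.ofReal (‖p.2.1 - θbar p.1‖ ^ 2 + (1 / (2 * τ)) * ‖p.2.2.1 - p.2.2.2‖ ^ 2) ∂γ

/-- The mixture marginal `μ_δ(A) = ∫ p(A | δ(z)) dμ(z)`. -/
def mixture {d m : ℕ} (μ : Measure (Vec d)) (k : Kernel (Vec m) (Vec d))
    (δ : Vec d → Vec m) : Measure (Vec d) :=
  μ.bind fun z => k (δ z)

/-- The observable-space-penalized objective
`E_τ(δ) = E_P[‖δ(Z)−Θ‖²] + (1/(2τ)) W₂²(μ_δ, μ)` (extended-real valued). -/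
def Eobj {d m : ℕ} (P : Measure (Vec d × Vec m)) (μ : Measure (Vec d))
    (k : Kernel (Vec m) (Vec d)) (τ : ℝ) (δ : Vec d → Vec m) : ℝ≥0∞ :=
  (∫⁻ p, ENNReal.ofReal (‖δ p.1 - p.2‖ ^ 2) ∂P) +
    ENNReal.ofReal (1 / (2 * τ)) * W2sq (mixture μ k δ) μ

section Aux
open Topology

lemma aux_lsc {X : Type*} [TopologicalSpace X] [MeasurableSpace X] [OpensMeasurableSpace X]
    {μ : Measure X} {μs : ℕ → Measure X} {f : X → ℝ} (f_meas : Measurable f) (f_nn : 0 ≤ f)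
    (hc : ∀ᵐ x ∂μ, ContinuousAt f x)
    (h_opens : ∀ G, IsOpen G → μ G ≤ atTop.liminf (fun i ↦ μs i G)) :
    ∫⁻ x, ENNReal.ofReal (f x) ∂μ ≤ atTop.liminf (fun i ↦ ∫⁻ x, ENNReal.ofReal (f x) ∂(μs i)) := by
  simp_rw [lintegral_eq_lintegral_meas_lt _ (Eventually.of_forall f_nn) f_meas.aemeasurable]
  calc ∫⁻ (t : ℝ) in Set.Ioi 0, μ {a | t < f a}
      ≤ ∫⁻ (t : ℝ) in Set.Ioi 0, atTop.liminf (fun i ↦ (μs i) {a | t < f a}) := ?_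
    _ ≤ atTop.liminf (fun i ↦ ∫⁻ (t : ℝ) in Set.Ioi 0, (μs i) {a | t < f a}) := ?_
  · refine lintegral_mono (fun t ↦ ?_)
    have h1 : μ {a | t < f a} ≤ μ (interior {a | t < f a}) := by
      apply measure_mono_ae
      filter_upwards [hc] with x hx hxt
      exact mem_interior_iff_mem_nhds.2 (hx.eventually (lt_mem_nhds hxt))
    refine h1.trans ((h_opens _ isOpen_interior).trans ?_)
    refine liminf_le_liminf (Eventually.of_forall fun i => measure_mono interior_subset) ?_ ?_
    · isBoundedDefault
    · isBoundedDefault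
  · exact lintegral_liminf_le (fun n ↦ Antitone.measurable (fun s t hst ↦
            measure_mono (fun ω hω ↦ lt_of_le_of_lt hst hω)))

lemma aux_memLp {X E : Type*} [MeasurableSpace X] [NormedAddCommGroup E] {μ : Measure X}
    {f : X → E} (hf : AEStronglyMeasurable f μ) :
    MemLp f 2 μ ↔ ∫⁻ x, ENNReal.ofReal (‖f x‖ ^ 2) ∂μ < ⊤ := by
  rw [memLp_two_iff_integrable_sq_norm hf, Integrable,
    hasFiniteIntegral_iff_ofReal (Eventually.of_forall fun x => by positivity)]
  exact and_iff_right (hf.norm.pow 2)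

lemma aux_tight {E : Type*} [NormedAddCommGroup E] [ProperSpace E] [MeasurableSpace E]
    [BorelSpace E] {S : Set (Measure E)} {C : ℝ≥0∞} (hC : C ≠ ⊤)
    (h : ∀ γ ∈ S, ∫⁻ x, ENNReal.ofReal (‖x‖ ^ 2) ∂γ ≤ C) : IsTightMeasureSet S := by
  apply isTightMeasureSet_of_tendsto_measure_norm_gt
  have h0 : Tendsto (fun r : ℝ => C / ENNReal.ofReal (r ^ 2)) atTop (𝓝 0) := by
    have : Tendsto (fun r : ℝ => ENNReal.ofReal (r ^ 2)) atTop (𝓝 ⊤) :=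
      ENNReal.tendsto_ofReal_atTop.comp (tendsto_pow_atTop (by norm_num))
    simpa using ENNReal.Tendsto.const_div this (Or.inr hC)
  refine tendsto_of_tendsto_of_tendsto_of_le_of_le' tendsto_const_nhds h0
    (Eventually.of_forall fun _ => zero_le) ?_
  filter_upwards [eventually_gt_atTop 0] with r hr
  refine iSup₂_le fun γ hγ => ?_
  have hm : Measurable fun x : E => ENNReal.ofReal (‖x‖ ^ 2) := by fun_prop
  refine le_trans (measure_mono ?_) ((meas_ge_le_lintegral_div hm.aemeasurable
    (ε := ENNReal.ofReal (r ^ 2)) (by simp; positivity) (by simp)).trans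
      (ENNReal.div_le_div_right (h γ hγ) _))
  intro x hx
  have hx : r < ‖x‖ := hx
  exact ENNReal.ofReal_le_ofReal (by gcongr)

lemma aux_feasible {d m : ℕ}
    (P : Measure (Vec d × Vec m)) [IsProbabilityMeasure P]
    (μ : Measure (Vec d)) (G : Measure (Vec m))
    (hμ : μ = P.map Prod.fst) (hG : G = P.map Prod.snd)
    (k : Kernel (Vec m) (Vec d)) [IsMarkovKernel k]
    (hPk : ∀ (A : Set (Vec d)) (B : Set (Vec m)), MeasurableSet A → MeasurableSet B →
      P (A ×ˢ B) = ∫⁻ θ in B, k θ A ∂G)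
    (Ω : Set (Vec m)) (hΩfull : G Ω = 1) :
    P.map (fun p => (p.1, p.2, p.1, p.1)) ∈ FeasibleSet μ Ω k := by
  have hm : Measurable (fun p : Vec d × Vec m => (p.1, p.2, p.1, p.1)) := by fun_prop
  have h2 : marg2 (P.map (fun p : Vec d × Vec m => (p.1, p.2, p.1, p.1))) = G := by
    rw [marg2, Measure.map_map (by fun_prop) hm, hG]; rfl
  refine ⟨Measure.isProbabilityMeasure_map hm.aemeasurable, ?_, ?_, ?_, ?_⟩
  · rw [h2, hΩfull]
  · rw [marg1, Measure.map_map (by fun_prop) hm, hμ]; rfl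
  · rw [marg4, Measure.map_map (by fun_prop) hm, hμ]; rfl
  · rw [h2, marg3, Measure.map_map (by fun_prop) hm]
    change _ = P.map Prod.fst
    ext A hA
    rw [Measure.bind_apply hA k.measurable.aemeasurable, Measure.map_apply measurable_fst hA]
    have := hPk A Set.univ hA MeasurableSet.univ
    rw [Set.prod_univ] at this
    rw [this, setLIntegral_univ]

lemma aux_meas {d m : ℕ} {θbar : Vec d → Vec m} (h : Measurable θbar) (τ : ℝ) :
    Measurable fun p : Vec d × Vec m × Vec d × Vec d =>
      ‖p.2.1 - θbar p.1‖ ^ 2 + (1 / (2 * τ)) * ‖p.2.2.1 - p.2.2.2‖ ^ 2 := by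
  fun_prop

lemma aux_moment {d m : ℕ} {μ : Measure (Vec d)} {Ω : Set (Vec m)} {k : Kernel (Vec m) (Vec d)}
    {θbar : Vec d → Vec m} (hθ : Measurable θbar) {τ : ℝ} (hτ : 0 < τ)
    {γ : Measure (Vec d × Vec m × Vec d × Vec d)} (hγ : γ ∈ FeasibleSet μ Ω k) :
    ∫⁻ p, ENNReal.ofReal (‖p‖ ^ 2) ∂γ ≤
      ENNReal.ofReal (2 + 4 * τ) * relaxCost θbar τ γ +
      4 * ∫⁻ z, ENNReal.ofReal (‖z‖ ^ 2) ∂μ + 2 * ∫⁻ z, ENNReal.ofReal (‖θbar z‖ ^ 2) ∂μ := by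
  obtain ⟨_, _, h1, h4, _⟩ := hγ
  have e1 : ∫⁻ z, ENNReal.ofReal (‖z‖ ^ 2) ∂μ = ∫⁻ p, ENNReal.ofReal (‖p.1‖ ^ 2) ∂γ := by
    rw [← h1, marg1, lintegral_map (by fun_prop) (by fun_prop)]
  have e4 : ∫⁻ z, ENNReal.ofReal (‖z‖ ^ 2) ∂μ = ∫⁻ p, ENNReal.ofReal (‖p.2.2.2‖ ^ 2) ∂γ := by
    rw [← h4, marg4, lintegral_map (by fun_prop) (by fun_prop)]
  have e2 : ∫⁻ z, ENNReal.ofReal (‖θbar z‖ ^ 2) ∂μ = ∫⁻ p, ENNReal.ofReal (‖θbar p.1‖ ^ 2) ∂γ := by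
    rw [← h1, marg1, lintegral_map (by fun_prop) (by fun_prop)]
  have e5 : 4 * ∫⁻ z, ENNReal.ofReal (‖z‖ ^ 2) ∂μ = ∫⁻ p, ENNReal.ofReal (‖p.1‖ ^ 2) ∂γ +
      3 * ∫⁻ p, ENNReal.ofReal (‖p.2.2.2‖ ^ 2) ∂γ := by
    rw [← e1, ← e4]; ring
  rw [e5, e2, relaxCost, ← lintegral_const_mul _ (aux_meas hθ τ).ennreal_ofReal,
    ← lintegral_const_mul _ (by fun_prop), ← lintegral_const_mul _ (by fun_prop),
    ← lintegral_add_left (by fun_prop),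
    ← lintegral_add_left ((aux_meas hθ τ).ennreal_ofReal.const_mul _),
    ← lintegral_add_right _ (by fun_prop)]
  refine lintegral_mono fun p => ?_
  obtain ⟨a, b, c, e⟩ := p
  have t3 : (3 : ℝ≥0∞) = ENNReal.ofReal 3 := by simp
  have t2 : (2 : ℝ≥0∞) * ENNReal.ofReal (‖θbar a‖ ^ 2) =
      ENNReal.ofReal 2 * ENNReal.ofReal (‖θbar a‖ ^ 2) := by simp
  simp only
  rw [t3, t2, ← ENNReal.ofReal_mul (by positivity), ← ENNReal.ofReal_mul (by positivity),
    ← ENNReal.ofReal_mul (by positivity), ← ENNReal.ofReal_add (by positivity) (by positivity),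
    ← ENNReal.ofReal_add (by positivity) (by positivity),
    ← ENNReal.ofReal_add (by positivity) (by positivity)]
  apply ENNReal.ofReal_le_ofReal
  have hb : ‖b‖ ^ 2 ≤ 2 * ‖b - θbar a‖ ^ 2 + 2 * ‖θbar a‖ ^ 2 := by
    have := norm_add_le (b - θbar a) (θbar a)
    rw [sub_add_cancel] at this
    nlinarith [norm_nonneg b, sq_nonneg (‖b - θbar a‖ - ‖θbar a‖)]
  have hc : ‖c‖ ^ 2 ≤ 2 * ‖c - e‖ ^ 2 + 2 * ‖e‖ ^ 2 := by
    have := norm_add_le (c - e) e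
    rw [sub_add_cancel] at this
    nlinarith [norm_nonneg c, sq_nonneg (‖c - e‖ - ‖e‖)]
  have hn : ‖(a, b, c, e)‖ ^ 2 ≤ ‖a‖ ^ 2 + ‖b‖ ^ 2 + ‖c‖ ^ 2 + ‖e‖ ^ 2 := by
    have n1 := sq_nonneg ‖a‖
    have n2 := sq_nonneg ‖b‖
    have n3 := sq_nonneg ‖c‖
    have n4 := sq_nonneg ‖e‖
    simp only [Prod.norm_def]
    rcases max_choice ‖a‖ (max ‖b‖ (max ‖c‖ ‖e‖)) with h | h <;> rw [h]
    · linarith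
    rcases max_choice ‖b‖ (max ‖c‖ ‖e‖) with h | h <;> rw [h]
    · linarith
    rcases max_choice ‖c‖ ‖e‖ with h | h <;> rw [h] <;> linarith
  have hx : (2 + 4 * τ) * (‖b - θbar a‖ ^ 2 + 1 / (2 * τ) * ‖c - e‖ ^ 2) =
      2 * ‖b - θbar a‖ ^ 2 + 2 * ‖c - e‖ ^ 2 + 4 * τ * ‖b - θbar a‖ ^ 2
        + 1 / τ * ‖c - e‖ ^ 2 := by
    field_simp; ring
  have p1 : 0 ≤ 4 * τ * ‖b - θbar a‖ ^ 2 := by positivity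
  have p2 : 0 ≤ 1 / τ * ‖c - e‖ ^ 2 := by positivity
  linarith

lemma aux_closed {d m : ℕ} {μ : Measure (Vec d)} {Ω : Set (Vec m)} (hΩ : IsClosed Ω)
    {k : Kernel (Vec m) (Vec d)} [IsMarkovKernel k]
    (hA4 : ∀ f : BoundedContinuousFunction (Vec d) ℝ,
      ContinuousOn (fun θ => ∫ z, f z ∂(k θ)) Ω)
    {γs : ℕ → ProbabilityMeasure (Vec d × Vec m × Vec d × Vec d)}
    {γ : ProbabilityMeasure (Vec d × Vec m × Vec d × Vec d)}
    (hlim : Tendsto γs atTop (𝓝 γ)) (hs : ∀ n, (γs n : Measure _) ∈ FeasibleSet μ Ω k) :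
    (γ : Measure _) ∈ FeasibleSet μ Ω k := by
  have key : ∀ {E : Type} [TopologicalSpace E] [MeasurableSpace E] [BorelSpace E]
      (f : Vec d × Vec m × Vec d × Vec d → E), Continuous f →
      ∀ g : BoundedContinuousFunction E ℝ,
        Tendsto (fun n => ∫ x, g x ∂((γs n : Measure _).map f)) atTop
          (𝓝 (∫ x, g x ∂((γ : Measure _).map f))) := by
    intro E _ _ _ f hf g
    have := ProbabilityMeasure.tendsto_map_of_tendsto_of_continuous _ _ hlim hf
    exact ProbabilityMeasure.tendsto_iff_forall_integral_tendsto.1 this g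
  have c2 : Continuous fun p : Vec d × Vec m × Vec d × Vec d => p.2.1 := by fun_prop
  have c3 : Continuous fun p : Vec d × Vec m × Vec d × Vec d => p.2.2.1 := by fun_prop
  have hfix : ∀ f : Vec d × Vec m × Vec d × Vec d → Vec d, Continuous f →
      (∀ n, (γs n : Measure _).map f = μ) → (γ : Measure _).map f = μ := by
    intro f hf h
    have : IsProbabilityMeasure μ := by
      rw [← h 0]; exact Measure.isProbabilityMeasure_map hf.measurable.aemeasurable
    have : IsProbabilityMeasure ((γ : Measure _).map f) :=
      Measure.isProbabilityMeasure_map hf.measurable.aemeasurable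
    refine ext_of_forall_integral_eq_of_IsFiniteMeasure fun g => ?_
    have := key f hf g
    simp only [h] at this
    exact tendsto_nhds_unique this tendsto_const_nhds
  have h2 : marg2 (γ : Measure (Vec d × Vec m × Vec d × Vec d)) Ω = 1 := by
    rw [marg2, Measure.map_apply c2.measurable hΩ.measurableSet]
    have hcl := ProbabilityMeasure.limsup_measure_closed_le_of_tendsto hlim (hΩ.preimage c2)
    have : ∀ n, (γs n : Measure (Vec d × Vec m × Vec d × Vec d)) ((fun p => p.2.1) ⁻¹' Ω) = 1 := fun n => by
      have := (hs n).2.1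
      rwa [marg2, Measure.map_apply c2.measurable hΩ.measurableSet] at this
    simp only [this, limsup_const] at hcl
    exact le_antisymm prob_le_one hcl
  refine ⟨inferInstance, h2, hfix _ (by fun_prop) fun n => (hs n).2.2.1,
    hfix _ (by fun_prop) fun n => (hs n).2.2.2.1, ?_⟩
  have p2 : ∀ γ : ProbabilityMeasure (Vec d × Vec m × Vec d × Vec d),
      IsProbabilityMeasure (marg2 (γ : Measure _)) := fun γ =>
    Measure.isProbabilityMeasure_map c2.measurable.aemeasurable
  have p3 : IsProbabilityMeasure (marg3 (γ : Measure (Vec d × Vec m × Vec d × Vec d))) :=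
    Measure.isProbabilityMeasure_map c3.measurable.aemeasurable
  refine ext_of_forall_integral_eq_of_IsFiniteMeasure fun f => ?_
  -- extension
  let g0 : BoundedContinuousFunction Ω ℝ :=
    BoundedContinuousFunction.ofNormedAddCommGroup (fun θ : Ω => ∫ z, f z ∂(k θ))
      (continuousOn_iff_continuous_domRestrict.1 (hA4 f)) ‖f‖ (fun θ => f.norm_integral_le_norm _)
  obtain ⟨g, -, hg⟩ := BoundedContinuousFunction.exists_extension_norm_eq_of_isClosedEmbedding g0
    hΩ.isClosedEmbedding_subtypeVal
  have hg' : ∀ θ ∈ Ω, g θ = ∫ z, f z ∂(k θ) := fun θ hθ => congrFun hg ⟨θ, hθ⟩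
  have hbind : ∀ ν : Measure (Vec m), IsProbabilityMeasure ν → ν Ω = 1 →
      ∫ z, f z ∂(ν.bind k) = ∫ θ, g θ ∂ν := by
    intro ν _ hν
    have hi : IsProbabilityMeasure (ν.bind k) := inferInstance
    have hcomp := Kernel.integral_comp (η := k) (κ := Kernel.const Unit ν) (a := ()) (f := f)
    rw [Kernel.comp_apply, Kernel.const_apply] at hcomp
    rw [hcomp]
    · refine integral_congr_ae ?_
      have : ∀ᵐ θ ∂ν, θ ∈ Ω := (prob_compl_eq_zero_iff hΩ.measurableSet).2 hν
      filter_upwards [this] with θ hθ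
      exact (hg' θ hθ).symm
    · exact f.integrable _
  have e1 := key _ c2 g
  have e2 := key _ c3 f
  rw [hbind _ (p2 γ) h2]
  refine tendsto_nhds_unique e1 (e2.congr fun n => ?_)
  have := (hs n).2.2.2.2
  change ∫ x, f x ∂(marg3 _) = ∫ x, g x ∂(marg2 _)
  rw [← this]
  exact hbind _ (p2 _) (hs n).2.1

end Aux

/-- Under Assumptions 1, 3, 4 and 5, for every `τ > 0` the infimum of
`∫ c_τ dγ` over `γ ∈ A` is finite and attained. -/
theorem stmt4 {d m : ℕ}
    (P : Measure (Vec d × Vec m)) [IsProbabilityMeasure P]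
    (μ : Measure (Vec d)) (G : Measure (Vec m))
    (hμ : μ = P.map Prod.fst) (hG : G = P.map Prod.snd)
    (θbar : Vec d → Vec m) (hθbar : IsPosteriorMean P θbar)
    (k : Kernel (Vec m) (Vec d)) [IsMarkovKernel k]
    (hPk : ∀ (A : Set (Vec d)) (B : Set (Vec m)), MeasurableSet A → MeasurableSet B →
      P (A ×ˢ B) = ∫⁻ θ in B, k θ A ∂G)
    -- `Ω` is closed and contains the support of `G*`
    (Ω : Set (Vec m)) (hΩclosed : IsClosed Ω) (hΩfull : G Ω = 1)
    -- Assumption 1 and Assumption 3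
    (hA1 : ∫⁻ θ, ENNReal.ofReal (‖θ‖ ^ 2) ∂G < ⊤)
    (hA3 : ∫⁻ z, ENNReal.ofReal (‖z‖ ^ 2) ∂μ < ⊤)
    -- Assumption 4 : weak continuity of `θ ↦ p(·|θ)` on `Ω`
    (hA4 : ∀ f : BoundedContinuousFunction (Vec d) ℝ,
      ContinuousOn (fun θ => ∫ z, f z ∂(k θ)) Ω)
    -- Assumption 5 : `θ̄` is continuous at `μ`-a.e. point
    (hA5 : ∀ᵐ z ∂μ, ContinuousAt θbar z)
    (τ : ℝ) (hτ : 0 < τ) :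
    (⨅ γ ∈ FeasibleSet μ Ω k, relaxCost θbar τ γ) < ⊤ ∧
    ∃ γstar ∈ FeasibleSet μ Ω k,
      relaxCost θbar τ γstar = ⨅ γ ∈ FeasibleSet μ Ω k, relaxCost θbar τ γ := by
  have hθm := hθbar.1
  have hμp : IsProbabilityMeasure μ := by
    rw [hμ]; exact Measure.isProbabilityMeasure_map measurable_fst.aemeasurable
  -- L2 facts
  have hΘ : MemLp (fun p : Vec d × Vec m => p.2) 2 P := by
    rw [aux_memLp (by fun_prop)]
    rw [hG, lintegral_map (by fun_prop) (by fun_prop)] at hA1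
    exact hA1
  have hθ2 : MemLp (fun p : Vec d × Vec m => θbar p.1) 2 P :=
    (memLp_congr_ae hθbar.2).2 (hΘ.condExp (by norm_num))
  have hθμ : ∫⁻ z, ENNReal.ofReal (‖θbar z‖ ^ 2) ∂μ < ⊤ := by
    rw [hμ, lintegral_map (by fun_prop) (by fun_prop)]
    exact (aux_memLp hθ2.1).1 hθ2
  have hfeas := aux_feasible P μ G hμ hG k hPk Ω hΩfull
  have hcost : relaxCost θbar τ (P.map (fun p => (p.1, p.2, p.1, p.1))) < ⊤ := by
    rw [relaxCost, lintegral_map (aux_meas hθm τ).ennreal_ofReal (by fun_prop)]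
    have := hΘ.sub hθ2
    simpa using (aux_memLp this.1).1 this
  have hlt : (⨅ γ ∈ FeasibleSet μ Ω k, relaxCost θbar τ γ) < ⊤ :=
    (iInf₂_le _ hfeas).trans_lt hcost
  refine ⟨hlt, ?_⟩
  have hinf : ∀ γ ∈ FeasibleSet μ Ω k,
      (⨅ γ ∈ FeasibleSet μ Ω k, relaxCost θbar τ γ) ≤ relaxCost θbar τ γ :=
    fun γ h => iInf₂_le γ h
  set I := ⨅ γ ∈ FeasibleSet μ Ω k, relaxCost θbar τ γ with hI
  have hex : ∀ n : ℕ, ∃ γ ∈ FeasibleSet μ Ω k, relaxCost θbar τ γ < I + ((n : ℝ≥0∞) + 1)⁻¹ := by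
    intro n
    have : I < I + ((n : ℝ≥0∞) + 1)⁻¹ :=
      ENNReal.lt_add_right hlt.ne (by simp)
    rw [hI] at this
    simpa only [iInf_lt_iff, exists_prop] using this
  choose γ0 hγ0 hγc using hex
  let γs : ℕ → ProbabilityMeasure (Vec d × Vec m × Vec d × Vec d) := fun n => ⟨γ0 n, (hγ0 n).1⟩
  have htight : IsTightMeasureSet
      {x | ∃ ν ∈ Set.range γs, (ν : Measure (Vec d × Vec m × Vec d × Vec d)) = x} := by
    refine aux_tight (C := ENNReal.ofReal (2 + 4 * τ) * (I + 1) +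
      4 * ∫⁻ z, ENNReal.ofReal (‖z‖ ^ 2) ∂μ + 2 * ∫⁻ z, ENNReal.ofReal (‖θbar z‖ ^ 2) ∂μ) ?_ ?_
    · refine ENNReal.add_ne_top.2 ⟨ENNReal.add_ne_top.2 ⟨?_, ?_⟩, ?_⟩
      · exact ENNReal.mul_ne_top ENNReal.ofReal_ne_top (ENNReal.add_ne_top.2 ⟨hlt.ne, by simp⟩)
      · exact ENNReal.mul_ne_top (by simp) hA3.ne
      · exact ENNReal.mul_ne_top (by simp) hθμ.ne
    · rintro _ ⟨_, ⟨n, rfl⟩, rfl⟩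
      have hmom := aux_moment hθm hτ (hγ0 n)
      change ∫⁻ x, ENNReal.ofReal (‖x‖ ^ 2) ∂(γ0 n) ≤ _
      refine le_trans hmom ?_
      have : relaxCost θbar τ (γ0 n) ≤ I + 1 := by
        refine (hγc n).le.trans ?_
        gcongr
        exact ENNReal.inv_le_one.2 (by simp)
      gcongr
  obtain ⟨γ, -, φ, hφ, hlim⟩ := (isCompact_closure_of_isTightMeasureSet htight).tendsto_subseq
    (x := γs) (fun n => subset_closure ⟨n, rfl⟩)
  have hmem : (γ : Measure (Vec d × Vec m × Vec d × Vec d)) ∈ FeasibleSet μ Ω k :=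
    aux_closed hΩclosed hA4 hlim fun n => hγ0 (φ n)
  refine ⟨γ, hmem, le_antisymm ?_ (hinf _ hmem)⟩
  have hcont : ∀ᵐ p ∂(γ : Measure (Vec d × Vec m × Vec d × Vec d)), ContinuousAt
      (fun p : Vec d × Vec m × Vec d × Vec d =>
        ‖p.2.1 - θbar p.1‖ ^ 2 + (1 / (2 * τ)) * ‖p.2.2.1 - p.2.2.2‖ ^ 2) p := by
    have h1 := hmem.2.2.1
    rw [← h1, marg1] at hA5
    have := ae_of_ae_map (by fun_prop) hA5
    filter_upwards [this] with p hp
    have hp' : ContinuousAt (fun p : Vec d × Vec m × Vec d × Vec d => θbar p.1) p :=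
      ContinuousAt.comp (f := fun p : Vec d × Vec m × Vec d × Vec d => p.1) hp
        continuous_fst.continuousAt
    fun_prop
  have hopen : ∀ U, IsOpen U → (γ : Measure (Vec d × Vec m × Vec d × Vec d)) U ≤
      atTop.liminf (fun i ↦ γ0 (φ i) U) :=
    fun U hU => ProbabilityMeasure.le_liminf_measure_open_of_tendsto hlim hU
  have hnn : 0 ≤ (fun p : Vec d × Vec m × Vec d × Vec d =>
        ‖p.2.1 - θbar p.1‖ ^ 2 + (1 / (2 * τ)) * ‖p.2.2.1 - p.2.2.2‖ ^ 2) := by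
    intro p
    have h1 : 0 ≤ 1 / (2 * τ) := by positivity
    exact add_nonneg (sq_nonneg _) (mul_nonneg h1 (sq_nonneg _))
  have hlsc : relaxCost θbar τ γ ≤ atTop.liminf (fun i ↦ relaxCost θbar τ (γ0 (φ i))) :=
    aux_lsc (aux_meas hθm τ) hnn hcont hopen
  refine hlsc.trans ?_
  have hup : Tendsto (fun n => I + (((φ n : ℕ) : ℝ≥0∞) + 1)⁻¹) atTop (nhds (I + 0)) := by
    refine Tendsto.const_add I ?_
    have h0 : Tendsto (fun n : ℕ => ((n : ℝ≥0∞) + 1)⁻¹) atTop (nhds 0) := by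
      have := (tendsto_add_atTop_iff_nat 1).2 ENNReal.tendsto_inv_nat_nhds_zero
      simpa using this
    exact h0.comp hφ.tendsto_atTop
  rw [add_zero] at hup
  rw [← hup.liminf_eq]
  exact liminf_le_liminf (Eventually.of_forall fun n => (hγc (φ n)).le)

end
end

section
/- Under Assumptions 1, 3, 4 and 5, if γ* minimizes ∫ c_τ dγ over A, then the projection γ*₁₂ of γ* onto its first two coordinates minimizes ∫|θ − θ̄(z)|² dπ(z,θ) over all couplings π ∈ Γ(γ*₁, γ*₂); if in addition Assumption 2 holds, then γ*₁₂ = (Id × δ_{γ*})♯μ, where δ_{γ*} ∈ L²(ℝ^d; ℝ^m; μ) is the μ-a.e. unique minimizer of ∫|δ(z) − θ̄(z)|² dμ(z) over measurable δ with δ♯μ = γ*₂. -/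
open MeasureTheory ProbabilityTheory Filter RealInnerProductSpace
open scoped ENNReal

noncomputable section

/-- Monotone closed sets are single valued a.e. -/
lemma mono_dir_null {m : ℕ} (Γ : Set (Vec m × Vec m)) (hc : IsClosed Γ)
    (hm : ∀ p ∈ Γ, ∀ q ∈ Γ, 0 ≤ inner ℝ (p.1 - q.1) (p.2 - q.2)) (e : Vec m) :
    ∀ᵐ y ∂(volume : Measure (Vec m)), ∀ a b, (y, a) ∈ Γ → (y, b) ∈ Γ →
      ¬ (0 < inner ℝ e (b - a)) := by
  let E : Set (Vec m) := {y | ∃ a b, (y, a) ∈ Γ ∧ (y, b) ∈ Γ ∧ 0 < inner ℝ e (b - a)}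
  have hEm : MeasurableSet E := by
    let C : ℕ → Set (Vec m × Vec m × Vec m) := fun n =>
      {t | (t.1, t.2.1) ∈ Γ ∧ (t.1, t.2.2) ∈ Γ ∧ 1 / ((n : ℝ) + 1) ≤ inner ℝ e (t.2.2 - t.2.1)}
    have hC : ∀ n, IsClosed (C n) := by
      intro n
      have g1 : Continuous fun t : Vec m × Vec m × Vec m => (t.1, t.2.1) := by fun_prop
      have g2 : Continuous fun t : Vec m × Vec m × Vec m => (t.1, t.2.2) := by fun_prop
      have g3 : Continuous fun t : Vec m × Vec m × Vec m => (inner ℝ e (t.2.2 - t.2.1) : ℝ) := by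
        fun_prop
      exact (hc.preimage g1).inter ((hc.preimage g2).inter (isClosed_le continuous_const g3))
    have hEC : E = ⋃ n, ⋃ j, Prod.fst '' (C n ∩ compactCovering (Vec m × Vec m × Vec m) j) := by
      ext y
      simp only [Set.mem_iUnion]
      constructor
      · rintro ⟨a, b, ha, hb, hab⟩
        obtain ⟨n, hn⟩ := exists_nat_one_div_lt hab
        obtain ⟨j, hj⟩ := exists_mem_compactCovering (y, a, b)
        exact ⟨n, j, (y, a, b), ⟨⟨ha, hb, hn.le⟩, hj⟩, rfl⟩
      · rintro ⟨n, j, ⟨y', a, b⟩, ⟨⟨ha, hb, hn⟩, hj⟩, rfl⟩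
        exact ⟨a, b, ha, hb, lt_of_lt_of_le (by positivity) hn⟩
    rw [hEC]
    refine MeasurableSet.iUnion fun n => MeasurableSet.iUnion fun j => ?_
    exact (((isCompact_compactCovering _ j).inter_left (hC n)).image continuous_fst).measurableSet
  have key : ∀ᵐ y ∂(volume : Measure (Vec m)), y ∈ Eᶜ := by
    refine ae_mem_of_ae_add_linearMap_mem (LinearMap.toSpanSingleton ℝ (Vec m) e)
      (volume : Measure ℝ) volume hEm.compl ?_
    intro y
    have hcount : {t : ℝ | y + t • e ∈ E}.Countable := by
      have h1 : ∀ t : ℝ, ∃ ab : Vec m × Vec m, y + t • e ∈ E →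
          (y + t • e, ab.1) ∈ Γ ∧ (y + t • e, ab.2) ∈ Γ ∧ 0 < inner ℝ e (ab.2 - ab.1) := by
        intro t
        by_cases h : y + t • e ∈ E
        · obtain ⟨a, b, h'⟩ := h
          exact ⟨(a, b), fun _ => h'⟩
        · exact ⟨0, fun h' => absurd h' h⟩
      choose ab hab using h1
      have hlt : ∀ s ∈ {t : ℝ | y + t • e ∈ E}, ∀ t ∈ {t : ℝ | y + t • e ∈ E}, s < t →
          inner ℝ e (ab s).2 ≤ inner ℝ e (ab t).1 := by
        intro s hs t ht hst
        have h := hm _ (hab t ht).1 _ (hab s hs).2.1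
        have h2 : (y + t • e) - (y + s • e) = (t - s) • e := by
          rw [sub_smul]; abel
        simp only [h2, inner_smul_left, inner_sub_right] at h
        have h3 : 0 < t - s := sub_pos.2 hst
        have h4 : 0 ≤ inner ℝ e (ab t).1 - inner ℝ e (ab s).2 := by
          by_contra hneg
          push Not at hneg
          have := mul_neg_of_pos_of_neg h3 hneg
          simp only [conj_trivial] at h
          linarith
        linarith
      refine Set.PairwiseDisjoint.countable_of_isOpen
        (s := fun t => Set.Ioo (inner ℝ e (ab t).1 : ℝ) (inner ℝ e (ab t).2)) ?_
        (fun _ _ => isOpen_Ioo) ?_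
      · intro s hs t ht hst
        rw [Function.onFun, Set.disjoint_left]
        rintro x ⟨hx1, hx2⟩ ⟨hx3, hx4⟩
        rcases lt_or_gt_of_ne hst with h | h
        · have := hlt s hs t ht h
          linarith
        · have := hlt t ht s hs h
          linarith
      · intro t ht
        have := (hab t ht).2.2
        rw [inner_sub_right] at this
        exact Set.nonempty_Ioo.2 (by linarith)
    have := hcount.ae_notMem (volume : Measure ℝ)
    filter_upwards [this] with t ht
    simpa [LinearMap.toSpanSingleton_apply] using ht
  filter_upwards [key] with y hy a b ha hb hab
  exact hy ⟨a, b, ha, hb, hab⟩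

lemma mono_single {m : ℕ} (Γ : Set (Vec m × Vec m)) (hc : IsClosed Γ)
    (hm : ∀ p ∈ Γ, ∀ q ∈ Γ, 0 ≤ inner ℝ (p.1 - q.1) (p.2 - q.2)) :
    ∀ᵐ y ∂(volume : Measure (Vec m)), ∀ a b, (y, a) ∈ Γ → (y, b) ∈ Γ → a = b := by
  have h : ∀ᵐ y ∂(volume : Measure (Vec m)), ∀ i : Fin m, ∀ a b, (y, a) ∈ Γ → (y, b) ∈ Γ →
      ¬ (0 < inner ℝ (EuclideanSpace.single i (1 : ℝ)) (b - a)) :=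
    ae_all_iff.2 fun i => mono_dir_null Γ hc hm _
  filter_upwards [h] with y hy a b ha hb
  ext i
  have h1 := hy i a b ha hb
  have h2 := hy i b a hb ha
  simp [EuclideanSpace.inner_single_left] at h1 h2
  linarith

/-- pairwise monotonicity of optimal plans -/
lemma opt_pair {d m : ℕ} (θbar : Vec d → Vec m) (hθ : Measurable θbar)
    (π : Measure (Vec d × Vec m)) [IsProbabilityMeasure π]
    (hfin : ∫⁻ p, ENNReal.ofReal (‖p.2 - θbar p.1‖ ^ 2) ∂π ≠ ⊤)
    (hopt : ∀ π' : Measure (Vec d × Vec m), IsCoupling π' (π.map Prod.fst) (π.map Prod.snd) →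
      ∫⁻ p, ENNReal.ofReal (‖p.2 - θbar p.1‖ ^ 2) ∂π ≤
        ∫⁻ p, ENNReal.ofReal (‖p.2 - θbar p.1‖ ^ 2) ∂π') :
    ∀ᵐ q ∂(π.prod π), 0 ≤ inner ℝ (θbar q.1.1 - θbar q.2.1) (q.1.2 - q.2.2) := by
  classical
  set Q := π.prod π with hQ
  let c : Vec d × Vec m → ℝ≥0∞ := fun p => ENNReal.ofReal (‖p.2 - θbar p.1‖ ^ 2)
  have hcm : Measurable c := by
    have : Measurable fun p : Vec d × Vec m => p.2 - θbar p.1 :=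
      measurable_snd.sub (hθ.comp measurable_fst)
    exact (this.norm.pow_const 2).ennreal_ofReal
  let S : Set ((Vec d × Vec m) × (Vec d × Vec m)) :=
    {q | inner ℝ (θbar q.1.1 - θbar q.2.1) (q.1.2 - q.2.2) < (0 : ℝ)}
  have hS : MeasurableSet S := by
    refine measurableSet_lt ?_ measurable_const
    refine Measurable.inner ?_ ?_
    · exact (hθ.comp (measurable_fst.comp measurable_fst)).sub
        (hθ.comp (measurable_fst.comp measurable_snd))
    · fun_prop
  have hSsymm : ∀ q, q.swap ∈ S ↔ q ∈ S := by
    intro q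
    simp only [S, Set.mem_ofPred_eq, Prod.fst_swap, Prod.snd_swap]
    rw [← neg_sub (θbar q.1.1), ← neg_sub q.1.2, inner_neg_neg]
  let Φ : (Vec d × Vec m) × (Vec d × Vec m) → Vec d × Vec m :=
    fun q => if q ∈ S then (q.1.1, q.2.2) else q.1
  have hΦ : Measurable Φ := Measurable.ite hS (by fun_prop) (by fun_prop)
  have hswap : Q.map Prod.swap = Q := Measure.prod_swap
  have hlsw : ∀ f : (Vec d × Vec m) × (Vec d × Vec m) → ℝ≥0∞, Measurable f →
      ∫⁻ q, f q.swap ∂Q = ∫⁻ q, f q ∂Q := by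
    intro f hf
    conv_rhs => rw [← hswap]
    rw [lintegral_map hf measurable_swap]
  have hQ1 : Q.map Prod.fst = π := by rw [hQ, Measure.map_fst_prod]; simp
  have hΦ1 : (Q.map Φ).map Prod.fst = π.map Prod.fst := by
    rw [Measure.map_map measurable_fst hΦ, ← hQ1, Measure.map_map measurable_fst measurable_fst]
    congr 1
    ext q : 1
    simp only [Function.comp, Φ]
    split_ifs <;> rfl
  have hΦ2 : (Q.map Φ).map Prod.snd = π.map Prod.snd := by
    rw [Measure.map_map measurable_snd hΦ]
    ext B hB
    rw [Measure.map_apply (measurable_snd.comp hΦ) hB, ← hQ1,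
      Measure.map_map measurable_snd measurable_fst,
      Measure.map_apply (measurable_snd.comp measurable_fst) hB,
      ← lintegral_indicator_one ((measurable_snd.comp hΦ) hB),
      ← lintegral_indicator_one ((measurable_snd.comp measurable_fst) hB)]
    let g : (Vec d × Vec m) × (Vec d × Vec m) → ℝ≥0∞ := fun q => B.indicator 1 q.1.2
    have hg : Measurable g := (measurable_one.indicator hB).comp (by fun_prop)
    have e1 : ∀ q, (Prod.snd ∘ Φ ⁻¹' B).indicator (1 : (Vec d × Vec m) × (Vec d × Vec m) → ℝ≥0∞) q
        = S.indicator g q.swap + Sᶜ.indicator g q := by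
      intro q
      by_cases h : q ∈ S
      · have h' := (hSsymm q).2 h
        simp [h, h', Φ, g, Set.indicator]
      · have h' : q.swap ∉ S := fun h2 => h ((hSsymm q).1 h2)
        simp [h, h', Φ, g, Set.indicator]
    have e2 : ∀ q, (Prod.snd ∘ Prod.fst ⁻¹' B).indicator (1 : (Vec d × Vec m) × (Vec d × Vec m) → ℝ≥0∞) q
        = S.indicator g q + Sᶜ.indicator g q := by
      intro q
      by_cases h : q ∈ S
      · simp [h, g, Set.indicator]
      · simp [h, g, Set.indicator]
    simp_rw [e1, e2]
    rw [lintegral_add_right _ (hg.indicator hS.compl), lintegral_add_right _ (hg.indicator hS.compl),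
      hlsw _ (hg.indicator hS)]
  have hle := hopt (Q.map Φ) ⟨hΦ1, hΦ2⟩
  change ∫⁻ p, c p ∂π ≤ ∫⁻ p, c p ∂(Q.map Φ) at hle
  change ∫⁻ p, c p ∂π ≠ ⊤ at hfin
  rw [lintegral_map hcm hΦ] at hle
  have hπQ : ∫⁻ p, c p ∂π = ∫⁻ q, c q.1 ∂Q := by
    conv_lhs => rw [← hQ1]
    rw [lintegral_map hcm measurable_fst]
  let f : (Vec d × Vec m) × (Vec d × Vec m) → ℝ≥0∞ := fun q => c (Φ q) + c (Φ q.swap)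
  let g : (Vec d × Vec m) × (Vec d × Vec m) → ℝ≥0∞ := fun q => c q.1 + c q.2
  have hfI : ∫⁻ q, f q ∂Q = ∫⁻ q, c (Φ q) ∂Q + ∫⁻ q, c (Φ q) ∂Q := by
    simp only [f]
    rw [lintegral_add_left (f := fun q => c (Φ q)) (hcm.comp hΦ), hlsw (fun q => c (Φ q)) (hcm.comp hΦ)]
  have hgI : ∫⁻ q, g q ∂Q = ∫⁻ p, c p ∂π + ∫⁻ p, c p ∂π := by
    simp only [g]
    rw [lintegral_add_left (f := fun q : (Vec d × Vec m) × (Vec d × Vec m) => c q.1) (hcm.comp measurable_fst), hπQ]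
    congr 1
    exact hlsw (fun q => c q.1) (hcm.comp measurable_fst)
  have hreal : ∀ q : (Vec d × Vec m) × (Vec d × Vec m),
      ‖q.2.2 - θbar q.1.1‖ ^ 2 + ‖q.1.2 - θbar q.2.1‖ ^ 2 =
      ‖q.1.2 - θbar q.1.1‖ ^ 2 + ‖q.2.2 - θbar q.2.1‖ ^ 2 +
        2 * inner ℝ (θbar q.1.1 - θbar q.2.1) (q.1.2 - q.2.2) := by
    intro q
    simp only [norm_sub_sq_real, inner_sub_left, inner_sub_right,
      real_inner_comm (θbar _) _]
    ring
  have hfS : ∀ q ∈ S, f q < g q := by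
    intro q hq
    have hq' := (hSsymm q).2 hq
    have hq2 : inner ℝ (θbar q.1.1 - θbar q.2.1) (q.1.2 - q.2.2) < (0 : ℝ) := hq
    simp only [f, g, Φ, hq, hq', if_true, c, Prod.fst_swap, Prod.snd_swap]
    rw [← ENNReal.ofReal_add (by positivity) (by positivity),
      ← ENNReal.ofReal_add (by positivity) (by positivity)]
    have := hreal q
    rw [ENNReal.ofReal_lt_ofReal_iff_of_nonneg (by positivity)]
    linarith
  have hfSc : ∀ q, q ∉ S → f q = g q := by
    intro q hq
    have hq' : q.swap ∉ S := fun h2 => hq ((hSsymm q).1 h2)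
    simp only [f, g, Φ, hq, hq', if_false, Prod.fst_swap]
  have hfg : ∀ q, f q ≤ g q := fun q => by
    by_cases h : q ∈ S
    · exact (hfS q h).le
    · exact (hfSc q h).le
  have hgfin : ∫⁻ q, g q ∂Q ≠ ⊤ := by rw [hgI]; exact ENNReal.add_ne_top.2 ⟨hfin, hfin⟩
  have hae := ae_eq_of_ae_le_of_lintegral_le (μ := Q) (f := f) (g := g)
    (Eventually.of_forall hfg) (ne_top_of_le_ne_top hgfin (lintegral_mono hfg))
    ((hcm.comp measurable_fst).add (hcm.comp measurable_snd)).aemeasurable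
    (by rw [hgI, hfI]; exact add_le_add hle hle)
  filter_upwards [hae] with q hq
  by_contra hneg
  push Not at hneg
  exact (hfS q hneg).ne hq

/-- optimal plans are concentrated on graphs -/
lemma opt_graph {d m : ℕ} (θbar : Vec d → Vec m) (hθ : Measurable θbar)
    (π : Measure (Vec d × Vec m)) [IsProbabilityMeasure π]
    (hac : (π.map Prod.fst).map θbar ≪ (volume : Measure (Vec m)))
    (hfin : ∫⁻ p, ENNReal.ofReal (‖p.2 - θbar p.1‖ ^ 2) ∂π ≠ ⊤)
    (hopt : ∀ π' : Measure (Vec d × Vec m), IsCoupling π' (π.map Prod.fst) (π.map Prod.snd) →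
      ∫⁻ p, ENNReal.ofReal (‖p.2 - θbar p.1‖ ^ 2) ∂π ≤
        ∫⁻ p, ENNReal.ofReal (‖p.2 - θbar p.1‖ ^ 2) ∂π') :
    ∃ δ : Vec d → Vec m, Measurable δ ∧ ∀ᵐ p ∂π, p.2 = δ p.1 := by
  have hpair := opt_pair θbar hθ π hfin hopt
  let F : Vec d × Vec m → Vec m × Vec m := fun p => (θbar p.1, p.2)
  have hF : Measurable F := (hθ.comp measurable_fst).prodMk measurable_snd
  let ρ : Measure (Vec m × Vec m) := π.map F
  have : IsProbabilityMeasure ρ := Measure.isProbabilityMeasure_map hF.aemeasurable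
  have hmono : ∀ p ∈ ρ.support, ∀ q ∈ ρ.support, 0 ≤ inner ℝ (p.1 - q.1) (p.2 - q.2) := by
    intro p hp q hq
    by_contra hneg
    push Not at hneg
    let T : Set ((Vec m × Vec m) × (Vec m × Vec m)) :=
      {q | inner ℝ (q.1.1 - q.2.1) (q.1.2 - q.2.2) < (0 : ℝ)}
    have hT : IsOpen T := isOpen_lt (by fun_prop) continuous_const
    have hmem : T ∈ nhds (p, q) := hT.mem_nhds hneg
    rw [mem_nhds_prod_iff] at hmem
    obtain ⟨U, hU, V, hV, hUV⟩ := hmem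
    have h0 : (ρ.prod ρ) T = 0 := by
      have : ρ.prod ρ = (π.prod π).map (Prod.map F F) := Measure.map_prod_map _ _ hF hF
      rw [this, Measure.map_apply (hF.prodMap hF) hT.measurableSet]
      rw [ae_iff] at hpair
      refine measure_mono_null ?_ hpair
      intro x hx
      exact not_le.2 hx
    have h1 := measure_mono_null hUV h0
    rw [Measure.prod_prod] at h1
    have h2 := (Measure.mem_support_iff_forall p).1 hp U hU
    have h3 := (Measure.mem_support_iff_forall q).1 hq V hV
    exact (ENNReal.mul_pos h2.ne' h3.ne').ne' h1
  have hsing := mono_single ρ.support Measure.isClosed_support hmono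
  have hsing2 : ∀ᵐ z ∂(π.map Prod.fst), ∀ a b, (θbar z, a) ∈ ρ.support →
      (θbar z, b) ∈ ρ.support → a = b := ae_of_ae_map hθ.aemeasurable (hac.ae_le hsing)
  have hsupp : ∀ᵐ p ∂π, (θbar p.1, p.2) ∈ ρ.support :=
    ae_of_ae_map hF.aemeasurable (Measure.support_mem_ae (μ := ρ))
  rw [← π.disintegrate π.condKernel] at hsupp
  have hsupp2 := Measure.ae_ae_of_ae_compProd hsupp
  let δ : Vec d → Vec m := fun z => ∫ θ, θ ∂(π.condKernel z)
  have hδ : Measurable δ :=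
    (StronglyMeasurable.integral_kernel (κ := π.condKernel) (f := fun θ : Vec m => θ)
      stronglyMeasurable_id).measurable
  refine ⟨δ, hδ, ?_⟩
  rw [← π.disintegrate π.condKernel]
  refine Measure.ae_compProd_of_ae_ae
    (measurableSet_eq_fun measurable_snd (hδ.comp measurable_fst)) ?_
  filter_upwards [hsing2, hsupp2] with z h1 h2
  obtain ⟨θ0, h0⟩ := h2.exists
  have h3 : ∀ᵐ θ ∂(π.condKernel z), θ = θ0 := by
    filter_upwards [h2] with θ hθ'
    exact h1 _ _ hθ' h0
  have h4 : δ z = θ0 := by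
    simp only [δ]
    rw [integral_congr_ae h3]
    simp
  filter_upwards [h3] with θ hh
  simp [hh, h4]


lemma memLp_two_iff' {X : Type*} [MeasurableSpace X] {n : ℕ} (ν : Measure X) (f : X → Vec n)
    (hf : AEStronglyMeasurable f ν) :
    MemLp f 2 ν ↔ ∫⁻ x, ENNReal.ofReal (‖f x‖ ^ 2) ∂ν < ⊤ := by
  have h : ∀ x, ENNReal.ofReal (‖f x‖ ^ 2) = ‖f x‖ₑ ^ (2 : ℝ≥0∞).toReal := by
    intro x
    rw [← ofReal_norm, ENNReal.ofReal_pow (norm_nonneg _)]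
    simp
  simp_rw [h]
  rw [← eLpNorm_lt_top_iff_lintegral_rpow_enorm_lt_top (by simp) (by simp)]
  exact ⟨fun h => h.2, fun h => ⟨hf, h⟩⟩

/-- Structure of minimizers of the relaxed problem: if `γ*` minimizes
`∫ c_τ dγ` over `A`, then its projection `γ*₁₂` onto the first two coordinates minimizes
`∫‖θ − θ̄(z)‖² dπ` over `π ∈ Γ(γ*₁, γ*₂)`; under Assumption 2 moreover
`γ*₁₂ = (Id × δ_{γ*})♯μ` where `δ_{γ*} ∈ L²` is the `μ`-a.e. unique minimizer of
`∫‖δ(z) − θ̄(z)‖² dμ` over measurable `δ` with `δ♯μ = γ*₂`. -/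
theorem stmt5 {d m : ℕ}
    (P : Measure (Vec d × Vec m)) [IsProbabilityMeasure P]
    (μ : Measure (Vec d)) (G : Measure (Vec m))
    (hμ : μ = P.map Prod.fst) (hG : G = P.map Prod.snd)
    (θbar : Vec d → Vec m) (hθbar : IsPosteriorMean P θbar)
    (k : Kernel (Vec m) (Vec d)) [IsMarkovKernel k]
    (hPk : ∀ (A : Set (Vec d)) (B : Set (Vec m)), MeasurableSet A → MeasurableSet B →
      P (A ×ˢ B) = ∫⁻ θ in B, k θ A ∂G)
    (Ω : Set (Vec m)) (hΩclosed : IsClosed Ω) (hΩfull : G Ω = 1)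
    (hA1 : ∫⁻ θ, ENNReal.ofReal (‖θ‖ ^ 2) ∂G < ⊤)
    (hA3 : ∫⁻ z, ENNReal.ofReal (‖z‖ ^ 2) ∂μ < ⊤)
    (hA4 : ∀ f : BoundedContinuousFunction (Vec d) ℝ,
      ContinuousOn (fun θ => ∫ z, f z ∂(k θ)) Ω)
    (hA5 : ∀ᵐ z ∂μ, ContinuousAt θbar z)
    (τ : ℝ) (hτ : 0 < τ)
    -- `γ*` minimizes the relaxed problem
    (γstar : Measure (Vec d × Vec m × Vec d × Vec d))
    (hγstarA : γstar ∈ FeasibleSet μ Ω k)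
    (hγstarmin : ∀ γ ∈ FeasibleSet μ Ω k, relaxCost θbar τ γstar ≤ relaxCost θbar τ γ) :
    -- `γ*₁₂` minimizes `∫‖θ − θ̄(z)‖² dπ` over `Γ(γ*₁, γ*₂)`
    (∀ π : Measure (Vec d × Vec m), IsCoupling π (marg1 γstar) (marg2 γstar) →
      ∫⁻ p, ENNReal.ofReal (‖p.2 - θbar p.1‖ ^ 2) ∂(γstar.map fun p => (p.1, p.2.1)) ≤
        ∫⁻ p, ENNReal.ofReal (‖p.2 - θbar p.1‖ ^ 2) ∂π) ∧
    -- under Assumption 2, `γ*₁₂ = (Id × δ_{γ*})♯μ` for the `μ`-a.e. unique minimizer of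
    -- the constrained projection problem
    ((μ.map θbar) ≪ (volume : Measure (Vec m)) →
      ∃ δγ : Vec d → Vec m, Measurable δγ ∧ MemLp δγ 2 μ ∧
        (γstar.map fun p => (p.1, p.2.1)) = (μ.map fun z => (z, δγ z)) ∧
        μ.map δγ = marg2 γstar ∧
        (∀ δ : Vec d → Vec m, Measurable δ → μ.map δ = marg2 γstar →
          ∫⁻ z, ENNReal.ofReal (‖δγ z - θbar z‖ ^ 2) ∂μ ≤
            ∫⁻ z, ENNReal.ofReal (‖δ z - θbar z‖ ^ 2) ∂μ) ∧
        (∀ δ : Vec d → Vec m, Measurable δ → μ.map δ = marg2 γstar →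
          (∫⁻ z, ENNReal.ofReal (‖δ z - θbar z‖ ^ 2) ∂μ =
            ∫⁻ z, ENNReal.ofReal (‖δγ z - θbar z‖ ^ 2) ∂μ) →
          δ =ᵐ[μ] δγ)) := by
  obtain ⟨hθm, hθe⟩ := hθbar
  obtain ⟨hγp, hγΩ, hγ1, hγ4, hγ3⟩ := hγstarA
  have hμp : IsProbabilityMeasure μ := by
    rw [hμ]; exact Measure.isProbabilityMeasure_map measurable_fst.aemeasurable
  have hGp : IsProbabilityMeasure G := by
    rw [hG]; exact Measure.isProbabilityMeasure_map measurable_snd.aemeasurable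
  -- the cost
  let c : Vec d × Vec m → ℝ≥0∞ := fun p => ENNReal.ofReal (‖p.2 - θbar p.1‖ ^ 2)
  have hcm : Measurable c := by
    have : Measurable fun p : Vec d × Vec m => p.2 - θbar p.1 :=
      measurable_snd.sub (hθm.comp measurable_fst)
    exact (this.norm.pow_const 2).ennreal_ofReal
  let w : Vec d × Vec d → ℝ≥0∞ := fun p => ENNReal.ofReal ((1 / (2 * τ)) * ‖p.1 - p.2‖ ^ 2)
  have hwm : Measurable w := by
    have : Measurable fun p : Vec d × Vec d => p.1 - p.2 := measurable_fst.sub measurable_snd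
    exact ((this.norm.pow_const 2).const_mul _).ennreal_ofReal
  have hm12 : Measurable fun p : Vec d × Vec m × Vec d × Vec d => (p.1, p.2.1) := by fun_prop
  have hm34 : Measurable fun p : Vec d × Vec m × Vec d × Vec d => p.2.2 := by fun_prop
  have hsplit : ∀ γ : Measure (Vec d × Vec m × Vec d × Vec d), relaxCost θbar τ γ =
      ∫⁻ p, c p ∂(γ.map fun p => (p.1, p.2.1)) + ∫⁻ p, w p ∂(γ.map fun p => p.2.2) := by
    intro γ
    rw [lintegral_map hcm hm12, lintegral_map hwm hm34]
    have hcm' : Measurable fun p : Vec d × Vec m × Vec d × Vec d => c (p.1, p.2.1) := hcm.comp hm12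
    rw [← lintegral_add_left hcm']
    unfold relaxCost
    refine lintegral_congr fun p => ?_
    simp only [c, w]
    rw [ENNReal.ofReal_add (by positivity) (by positivity)]
  -- L² facts
  have hΘ : MemLp (fun p : Vec d × Vec m => p.2) 2 P := by
    rw [memLp_two_iff' _ _ measurable_snd.aestronglyMeasurable]
    rw [hG, lintegral_map (by fun_prop) measurable_snd] at hA1
    exact hA1
  have hθP : MemLp (fun p : Vec d × Vec m => θbar p.1) 2 P :=
    (memLp_congr_ae hθe).2 (hΘ.condExp (by norm_num))
  have hθμ : MemLp θbar 2 μ := by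
    rw [hμ]
    exact (memLp_map_measure_iff hθm.aestronglyMeasurable measurable_fst.aemeasurable).2 hθP
  have hcP : ∫⁻ p, c p ∂P < ⊤ :=
    (memLp_two_iff' P (fun p => p.2 - θbar p.1) (hΘ.sub hθP).1).1 (hΘ.sub hθP)
  -- finiteness of the optimal cost
  have hfin : relaxCost θbar τ γstar < ⊤ := by
    let J : Vec d × Vec m → Vec d × Vec m × Vec d × Vec d := fun p => (p.1, p.2, p.1, p.1)
    have hJ : Measurable J := by fun_prop
    have hbind : G.bind (fun θ => k θ) = μ := by
      ext A hA
      rw [Measure.bind_apply hA k.measurable.aemeasurable, hμ,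
        Measure.map_apply measurable_fst hA]
      have := hPk A Set.univ hA MeasurableSet.univ
      rw [Measure.restrict_univ, Set.prod_univ] at this
      exact this.symm
    have h1 : marg1 (P.map J) = μ := by
      rw [marg1, Measure.map_map (by fun_prop) hJ, hμ]; rfl
    have h2 : marg2 (P.map J) = G := by
      rw [marg2, Measure.map_map (by fun_prop) hJ, hG]; rfl
    have h3 : marg3 (P.map J) = μ := by
      rw [marg3, Measure.map_map (by fun_prop) hJ, hμ]; rfl
    have h4 : marg4 (P.map J) = μ := by
      rw [marg4, Measure.map_map (by fun_prop) hJ, hμ]; rfl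
    refine lt_of_le_of_lt (hγstarmin (P.map J) ⟨Measure.isProbabilityMeasure_map hJ.aemeasurable,
      by rw [h2, hΩfull], h1, h4, by rw [h2, h3, hbind]⟩) ?_
    rw [hsplit, Measure.map_map hm12 hJ, Measure.map_map hm34 hJ,
      lintegral_map hwm (hm34.comp hJ)]
    have e1 : ((fun p : Vec d × Vec m × Vec d × Vec d => (p.1, p.2.1)) ∘ J) = id := rfl
    rw [e1, Measure.map_id]
    simpa [w, J] using hcP
  set π0 : Measure (Vec d × Vec m) := γstar.map fun p => (p.1, p.2.1) with hπ0
  have hπ0p : IsProbabilityMeasure π0 := Measure.isProbabilityMeasure_map hm12.aemeasurable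
  set κ : Measure (Vec d × Vec d) := γstar.map fun p => p.2.2 with hκ
  have hκp : IsProbabilityMeasure κ := Measure.isProbabilityMeasure_map hm34.aemeasurable
  have hfin' : ∫⁻ p, c p ∂π0 + ∫⁻ p, w p ∂κ < ⊤ := by rw [← hsplit]; exact hfin
  have hπ0fin : ∫⁻ p, c p ∂π0 ≠ ⊤ := (ENNReal.add_lt_top.1 hfin').1.ne
  have hκfin : ∫⁻ p, w p ∂κ ≠ ⊤ := (ENNReal.add_lt_top.1 hfin').2.ne
  have hπ01 : π0.map Prod.fst = μ := by
    rw [hπ0, Measure.map_map measurable_fst hm12, ← hγ1]; rfl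
  have hπ02 : π0.map Prod.snd = marg2 γstar := by
    rw [hπ0, Measure.map_map measurable_snd hm12]; rfl
  have part1 : ∀ π : Measure (Vec d × Vec m), IsCoupling π (marg1 γstar) (marg2 γstar) →
      ∫⁻ p, c p ∂π0 ≤ ∫⁻ p, c p ∂π := by
    intro π hπ
    have hπp : IsProbabilityMeasure π := by
      constructor
      have := congrArg (fun ν => ν Set.univ) hπ.1
      simp only [hγ1] at this
      rw [Measure.map_apply measurable_fst MeasurableSet.univ] at this
      simpa using this
    let J : (Vec d × Vec m) × (Vec d × Vec d) → Vec d × Vec m × Vec d × Vec d :=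
      fun p => (p.1.1, p.1.2, p.2)
    have hJ : Measurable J := by fun_prop
    let γ := (π.prod κ).map J
    have hg12 : γ.map (fun p => (p.1, p.2.1)) = π := by
      have : (fun p : Vec d × Vec m × Vec d × Vec d => (p.1, p.2.1)) ∘ J = Prod.fst := rfl
      rw [Measure.map_map hm12 hJ, this, Measure.map_fst_prod]; simp
    have hg34 : γ.map (fun p => p.2.2) = κ := by
      have : (fun p : Vec d × Vec m × Vec d × Vec d => p.2.2) ∘ J = Prod.snd := rfl
      rw [Measure.map_map hm34 hJ, this, Measure.map_snd_prod]; simp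
    have h1 : marg1 γ = μ := by
      have : marg1 γ = (γ.map (fun p => (p.1, p.2.1))).map Prod.fst := by
        rw [Measure.map_map measurable_fst hm12]; rfl
      rw [this, hg12, hπ.1, hγ1]
    have h2 : marg2 γ = marg2 γstar := by
      have : marg2 γ = (γ.map (fun p => (p.1, p.2.1))).map Prod.snd := by
        rw [Measure.map_map measurable_snd hm12]; rfl
      rw [this, hg12, hπ.2]
    have h3 : marg3 γ = marg3 γstar := by
      have : ∀ γ : Measure (Vec d × Vec m × Vec d × Vec d),
          marg3 γ = (γ.map (fun p => p.2.2)).map Prod.fst := by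
        intro γ
        rw [Measure.map_map measurable_fst hm34]; rfl
      rw [this, this, hg34]
    have h4 : marg4 γ = marg4 γstar := by
      have : ∀ γ : Measure (Vec d × Vec m × Vec d × Vec d),
          marg4 γ = (γ.map (fun p => p.2.2)).map Prod.snd := by
        intro γ
        rw [Measure.map_map measurable_snd hm34]; rfl
      rw [this, this, hg34]
    have hle := hγstarmin γ ⟨Measure.isProbabilityMeasure_map hJ.aemeasurable,
      by rw [h2, hγΩ], h1, by rw [h4, hγ4], by rw [h2, h3, hγ3]⟩
    rw [hsplit, hsplit, hg12, hg34, ← hκ] at hle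
    exact (ENNReal.add_le_add_iff_right hκfin).1 hle
  refine ⟨part1, fun hac => ?_⟩
  -- any finite-cost optimal coupling is a graph
  have hgraph : ∀ π : Measure (Vec d × Vec m), IsProbabilityMeasure π → π.map Prod.fst = μ →
      π.map Prod.snd = marg2 γstar → ∫⁻ p, c p ∂π = ∫⁻ p, c p ∂π0 →
      ∃ δ : Vec d → Vec m, Measurable δ ∧ ∀ᵐ p ∂π, p.2 = δ p.1 := by
    intro π hπp h1 h2 hcost
    refine opt_graph θbar hθm π (by rw [h1]; exact hac) ?_ ?_
    · change ∫⁻ p, c p ∂π ≠ ⊤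
      rw [hcost]; exact hπ0fin
    · intro π' hπ'
      change ∫⁻ p, c p ∂π ≤ ∫⁻ p, c p ∂π'
      rw [hcost]
      exact part1 π' (by rw [hγ1, ← h1, ← h2]; exact hπ')
  have hmid : ∀ δ : Vec d → Vec m, Measurable δ → Measurable fun z => (z, δ z) :=
    fun δ hδ => measurable_id.prodMk hδ
  have hcostδ : ∀ δ : Vec d → Vec m, Measurable δ →
      ∫⁻ p, c p ∂(μ.map fun z => (z, δ z)) = ∫⁻ z, ENNReal.ofReal (‖δ z - θbar z‖ ^ 2) ∂μ := by
    intro δ hδ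
    rw [lintegral_map hcm (hmid δ hδ)]
  have hδ1 : ∀ δ : Vec d → Vec m, Measurable δ → (μ.map fun z => (z, δ z)).map Prod.fst = μ := by
    intro δ hδ
    rw [Measure.map_map measurable_fst (hmid δ hδ)]
    exact Measure.map_id
  have hδ2 : ∀ δ : Vec d → Vec m, Measurable δ →
      (μ.map fun z => (z, δ z)).map Prod.snd = μ.map δ := by
    intro δ hδ
    rw [Measure.map_map measurable_snd (hmid δ hδ)]
    rfl
  obtain ⟨δγ, hδm, hδe⟩ := hgraph π0 hπ0p hπ01 hπ02 rfl
  have hπ0δ : π0 = μ.map fun z => (z, δγ z) := by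
    rw [← hπ01, Measure.map_map (hmid _ hδm) measurable_fst]
    conv_lhs => rw [← Measure.map_id (μ := π0)]
    refine Measure.map_congr ?_
    filter_upwards [hδe] with p hp
    exact Prod.ext rfl hp
  have hmarg : μ.map δγ = marg2 γstar := by rw [← hδ2 _ hδm, ← hπ0δ, hπ02]
  have hcδγ := hcostδ δγ hδm
  rw [← hπ0δ] at hcδγ
  refine ⟨δγ, hδm, ?_, hπ0δ, hmarg, ?_, ?_⟩
  · have h : MemLp (fun z => δγ z - θbar z) 2 μ := by
      refine (memLp_two_iff' _ _ (hδm.sub hθm).aestronglyMeasurable).2 ?_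
      change ∫⁻ z, ENNReal.ofReal (‖δγ z - θbar z‖ ^ 2) ∂μ < ⊤
      rw [← hcδγ]
      exact lt_top_iff_ne_top.2 hπ0fin
    have h2 := h.add hθμ
    convert h2 using 1
    ext z : 1
    simp
  · intro δ hδ hδν
    rw [← hcδγ, ← hcostδ δ hδ]
    exact part1 _ ⟨by rw [hδ1 δ hδ, hγ1], by rw [hδ2 δ hδ, hδν]⟩
  · intro δ hδ hδν hcost
    rw [← hcδγ, ← hcostδ δ hδ] at hcost
    set π1 : Measure (Vec d × Vec m) := μ.map fun z => (z, δ z) with hπ1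
    have hπ1p : IsProbabilityMeasure π1 :=
      Measure.isProbabilityMeasure_map (hmid δ hδ).aemeasurable
    have half : ∀ x : ℝ≥0∞, (2 : ℝ≥0∞)⁻¹ * (x + x) = x := by
      intro x
      rw [← two_mul, ← mul_assoc, ENNReal.inv_mul_cancel (by simp) (by simp), one_mul]
    have halfm : ∀ (n : ℕ) (ν : Measure (Vec n)), (2 : ℝ≥0∞)⁻¹ • (ν + ν) = ν := by
      intro n ν
      ext s hs
      rw [Measure.smul_apply, Measure.add_apply, smul_eq_mul, half]
    have hmix : IsProbabilityMeasure ((2 : ℝ≥0∞)⁻¹ • (π0 + π1)) := by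
      constructor
      simp only [Measure.smul_apply, Measure.add_apply, measure_univ, smul_eq_mul]
      exact half 1
    obtain ⟨δ', hδ'm, hδ'e⟩ := hgraph ((2 : ℝ≥0∞)⁻¹ • (π0 + π1)) hmix
      (by rw [Measure.map_smul, Measure.map_add _ _ measurable_fst, hπ01, hδ1 δ hδ, halfm])
      (by rw [Measure.map_smul, Measure.map_add _ _ measurable_snd, hπ02, hδ2 δ hδ, hδν, halfm])
      (by rw [lintegral_smul_measure, lintegral_add_measure, hcost, smul_eq_mul, half])
    have hadd : ∀ᵐ p ∂(π0 + π1), p.2 = δ' p.1 :=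
      (Measure.ae_ennreal_smul_measure_iff (by simp)).1 hδ'e
    rw [ae_add_measure_iff] at hadd
    obtain ⟨ha, hb⟩ := hadd
    rw [hπ0δ] at ha
    have ha' := ae_of_ae_map (hmid δγ hδm).aemeasurable ha
    have hb' := ae_of_ae_map (hmid δ hδ).aemeasurable hb
    filter_upwards [ha', hb'] with z h1 h2
    rw [h1, h2]


end
end
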